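/- arXiv:0902.2019 — 7 statements merged into one kernel-verified Lean document; each statement's English description precedes it below -/
import Mathlib

section
/- For every c > 0 and all r > 0, z > 0, the function Γ_c satisfies the axially symmetric hyperbolic Laplace equation ∂²Γ_c/∂r² + (1/r)·∂Γ_c/∂r + ∂²Γ_c/∂z² − (1/z)·∂Γ_c/∂z = 0 (all the indicated partial derivatives existing); i.e., Γ_c is harmonic for the hyperbolic metric z^{−2}(dx² + dy² + dz²) on the upper half-space away from the monopole point (0,0,c). -/
/-- LeBrun's hyperbolic Green's function with monopole point `(0,0,c)`,
in cylindrical coordinates `(r,z)` on the upper half-space model. -/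
noncomputable def Gam (c r z : ℝ) : ℝ :=
  -1/2 + (r^2 + z^2 + c^2) / (2 * Real.sqrt ((r^2 + z^2 + c^2)^2 - 4*c^2*z^2))

/-- The radicand in the Green's function is positive off the axis. -/
lemma gam_radicand_pos (c z : ℝ) {r : ℝ} (hr : 0 < r) :
    0 < (r^2 + z^2 + c^2)^2 - 4*c^2*z^2 := by
  have h : (r^2 + z^2 + c^2)^2 - 4*c^2*z^2 = (r^2 + (z - c)^2) * (r^2 + (z + c)^2) := by ring
  rw [h]
  positivity

lemma hasDerivAt_div_two_mul_sqrt {N D : ℝ → ℝ} {n d x : ℝ} (hN : HasDerivAt N n x)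
    (hD : HasDerivAt D d x) (hpos : 0 < D x) :
    HasDerivAt (fun y => N y / (2 * Real.sqrt (D y)))
      ((2 * n * D x - N x * d) / (4 * (D x * Real.sqrt (D x)))) x := by
  have hs : 0 < Real.sqrt (D x) := Real.sqrt_pos.2 hpos
  have hsq : Real.sqrt (D x) ^ 2 = D x := Real.sq_sqrt hpos.le
  refine (hN.div ((hD.sqrt hpos.ne').const_mul 2) (by positivity)).congr_deriv ?_
  generalize Real.sqrt (D x) = s at *
  rw [← hsq]
  field_simp
  ring

lemma hasDerivAt_div_mul_sqrt {N D : ℝ → ℝ} {n d x : ℝ} (hN : HasDerivAt N n x)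
    (hD : HasDerivAt D d x) (hpos : 0 < D x) :
    HasDerivAt (fun y => N y / (D y * Real.sqrt (D y)))
      ((2 * n * D x - 3 * N x * d) / (2 * (D x ^ 2 * Real.sqrt (D x)))) x := by
  have hs : 0 < Real.sqrt (D x) := Real.sqrt_pos.2 hpos
  have hsq : Real.sqrt (D x) ^ 2 = D x := Real.sq_sqrt hpos.le
  refine (hN.div (hD.mul (hD.sqrt hpos.ne')) (mul_pos hpos hs).ne').congr_deriv ?_
  simp only [Pi.mul_apply]
  generalize Real.sqrt (D x) = s at *
  rw [← hsq]
  field_simp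
  ring

lemma hasDerivAt_sq_add_sq_add_sq_left (c r z : ℝ) :
    HasDerivAt (fun x : ℝ => x^2 + z^2 + c^2) (2 * r) r := by
  simpa using ((hasDerivAt_pow 2 r).add_const (z^2)).add_const (c^2)

lemma hasDerivAt_sq_add_sq_add_sq_right (c r z : ℝ) :
    HasDerivAt (fun x : ℝ => r^2 + x^2 + c^2) (2 * z) z := by
  simpa using ((hasDerivAt_pow 2 z).const_add (r^2)).add_const (c^2)

lemma hasDerivAt_gam_radicand_left (c r z : ℝ) :
    HasDerivAt (fun x : ℝ => (x^2 + z^2 + c^2)^2 - 4*c^2*z^2)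
      (4 * r * (r^2 + z^2 + c^2)) r := by
  refine (((hasDerivAt_sq_add_sq_add_sq_left c r z).pow 2).sub_const _).congr_deriv ?_
  push_cast
  ring

lemma hasDerivAt_gam_radicand_right (c r z : ℝ) :
    HasDerivAt (fun x : ℝ => (r^2 + x^2 + c^2)^2 - 4*c^2*x^2)
      (4 * z * (r^2 + z^2 - c^2)) z := by
  refine (((hasDerivAt_sq_add_sq_add_sq_right c r z).pow 2).sub
    ((hasDerivAt_pow 2 z).const_mul (4*c^2))).congr_deriv ?_
  push_cast
  ring

lemma hasDerivAt_gam_left (c z : ℝ) {r : ℝ} (hr : 0 < r) :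
    HasDerivAt (fun x => Gam c x z)
      (-4 * c^2 * z^2 * r / (((r^2 + z^2 + c^2)^2 - 4*c^2*z^2) *
        Real.sqrt ((r^2 + z^2 + c^2)^2 - 4*c^2*z^2))) r := by
  have hD := gam_radicand_pos c z hr
  have hs := Real.sqrt_pos.2 hD
  refine ((hasDerivAt_div_two_mul_sqrt (hasDerivAt_sq_add_sq_add_sq_left c r z)
    (hasDerivAt_gam_radicand_left c r z) hD).const_add (-1/2)).congr_deriv ?_
  rw [div_eq_div_iff (by positivity) (by positivity)]
  ring

lemma hasDerivAt_gam_right (c z : ℝ) {r : ℝ} (hr : 0 < r) :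
    HasDerivAt (fun x => Gam c r x)
      (2 * c^2 * (z * (r^2 + c^2 - z^2)) / (((r^2 + z^2 + c^2)^2 - 4*c^2*z^2) *
        Real.sqrt ((r^2 + z^2 + c^2)^2 - 4*c^2*z^2))) z := by
  have hD := gam_radicand_pos c z hr
  have hs := Real.sqrt_pos.2 hD
  refine ((hasDerivAt_div_two_mul_sqrt (hasDerivAt_sq_add_sq_add_sq_right c r z)
    (hasDerivAt_gam_radicand_right c r z) hD).const_add (-1/2)).congr_deriv ?_
  rw [div_eq_div_iff (by positivity) (by positivity)]
  ring

/-- For every `c > 0` and all `r > 0`, `z > 0`, the Green's function `Γ_c` satisfies the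
axially symmetric hyperbolic Laplace equation
`Γ_rr + (1/r)·Γ_r + Γ_zz − (1/z)·Γ_z = 0`, all the indicated partial derivatives existing;
i.e. `Γ_c` is harmonic for the hyperbolic metric away from the monopole point. -/
theorem stmt_4 (c : ℝ) (hc : 0 < c) (r z : ℝ) (hr : 0 < r) (hz : 0 < z) :
    DifferentiableAt ℝ (fun r' => Gam c r' z) r ∧
    DifferentiableAt ℝ (fun r' => deriv (fun r'' => Gam c r'' z) r') r ∧
    DifferentiableAt ℝ (fun z' => Gam c r z') z ∧
    DifferentiableAt ℝ (fun z' => deriv (fun z'' => Gam c r z'') z') z ∧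
    deriv (fun r' => deriv (fun r'' => Gam c r'' z) r') r
      + (1/r) * deriv (fun r' => Gam c r' z) r
      + deriv (fun z' => deriv (fun z'' => Gam c r z'') z') z
      - (1/z) * deriv (fun z' => Gam c r z') z = 0 := by
  have hD := gam_radicand_pos c z hr
  have hs := Real.sqrt_pos.2 hD
  have hr₁ := hasDerivAt_gam_left c z hr
  have hz₁ := hasDerivAt_gam_right c z hr
  have hr₂ := (hasDerivAt_div_mul_sqrt ((hasDerivAt_id r).const_mul (-4 * c^2 * z^2))
    (hasDerivAt_gam_radicand_left c r z) hD).congr_of_eventuallyEq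
      ((eventually_gt_nhds hr).mono fun x hx => (hasDerivAt_gam_left c z hx).deriv)
  have hN : HasDerivAt (fun x : ℝ => 2 * c^2 * (x * (r^2 + c^2 - x^2)))
      (2 * c^2 * (r^2 + c^2 - 3 * z^2)) z := by
    refine (((hasDerivAt_id z).mul
      ((hasDerivAt_pow 2 z).const_sub (r^2 + c^2))).const_mul (2 * c^2)).congr_deriv ?_
    simp only [id]
    push_cast
    ring
  have hz₂ := (hasDerivAt_div_mul_sqrt hN
    (hasDerivAt_gam_radicand_right c r z) hD).congr_of_eventuallyEq
      (Filter.Eventually.of_forall fun x => (hasDerivAt_gam_right c x hr).deriv)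
  refine ⟨hr₁.differentiableAt, hr₂.differentiableAt, hz₁.differentiableAt,
    hz₂.differentiableAt, ?_⟩
  rw [hr₁.deriv, hr₂.deriv, hz₁.deriv, hz₂.deriv]
  simp only [id]
  generalize Real.sqrt ((r^2 + z^2 + c^2)^2 - 4*c^2*z^2) = s at *
  obtain ⟨D, hDe⟩ : ∃ D, D = (r^2 + z^2 + c^2)^2 - 4*c^2*z^2 := ⟨_, rfl⟩
  rw [← hDe] at hD ⊢
  field_simp
  rw [hDe]
  ring
end

section
/- Fix λ ∈ ℝ with 3/2 < λ < 2, and set α = √(4 − 2λ), β = √(2λ − 2). Then: (i) the image of Z̃ under the projection (w₀,w₁,z₂,z₃,w₄,w₅) ↦ (z₂,z₃,w₄,w₅) is exactly {(z₂,z₃,w₄,w₅) ∈ ℂ⁴ : α²z₂² + z₃² + 2w₄w₅ = 0}; and (ii) the image of Z̃ under the projection (w₀,w₁,z₂,z₃,w₄,w₅) ↦ (w₀,w₁,z₂,z₃) is exactly {(w₀,w₁,z₂,z₃) ∈ ℂ⁴ : 2w₀w₁ + β²z₂² + z₃² = 0}. -/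
open Complex

/-- On `ℂ⁶` with coordinates `(w₀,w₁,z₂,z₃,w₄,w₅)`, let `Z̃` be the common zero set of
`h₀ = 2w₀w₁ + λz₂² + (3/2)z₃² + w₄w₅` and `h_∞ = w₀w₁ + z₂² + z₃² + w₄w₅`, for
`3/2 < λ < 2`, and set `α = √(4 − 2λ)`, `β = √(2λ − 2)`. Then (i) the image of `Z̃`
under `(w₀,w₁,z₂,z₃,w₄,w₅) ↦ (z₂,z₃,w₄,w₅)` is exactly `{α²z₂² + z₃² + 2w₄w₅ = 0}`,
and (ii) the image under `(w₀,w₁,z₂,z₃,w₄,w₅) ↦ (w₀,w₁,z₂,z₃)` is exactly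
`{2w₀w₁ + β²z₂² + z₃² = 0}`. -/
theorem stmt_7 (lam α β : ℝ) (h₁ : 3/2 < lam) (h₂ : lam < 2)
    (hα : α = Real.sqrt (4 - 2*lam)) (hβ : β = Real.sqrt (2*lam - 2)) :
    ({p : ℂ × ℂ × ℂ × ℂ | ∃ w₀ w₁ : ℂ,
        2*w₀*w₁ + (lam : ℂ)*p.1^2 + (3/2 : ℂ)*p.2.1^2 + p.2.2.1*p.2.2.2 = 0 ∧
        w₀*w₁ + p.1^2 + p.2.1^2 + p.2.2.1*p.2.2.2 = 0}
      = {p : ℂ × ℂ × ℂ × ℂ | (α : ℂ)^2*p.1^2 + p.2.1^2 + 2*p.2.2.1*p.2.2.2 = 0}) ∧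
    ({p : ℂ × ℂ × ℂ × ℂ | ∃ w₄ w₅ : ℂ,
        2*p.1*p.2.1 + (lam : ℂ)*p.2.2.1^2 + (3/2 : ℂ)*p.2.2.2^2 + w₄*w₅ = 0 ∧
        p.1*p.2.1 + p.2.2.1^2 + p.2.2.2^2 + w₄*w₅ = 0}
      = {p : ℂ × ℂ × ℂ × ℂ | 2*p.1*p.2.1 + (β : ℂ)^2*p.2.2.1^2 + p.2.2.2^2 = 0}) := by
  have hα' : (α : ℂ)^2 = 4 - 2*lam := by
    have h : α^2 = 4 - 2*lam := by rw [hα, Real.sq_sqrt (by linarith)]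
    exact_mod_cast congrArg (fun x : ℝ => (x : ℂ)) h
  have hβ' : (β : ℂ)^2 = 2*lam - 2 := by
    have h : β^2 = 2*lam - 2 := by rw [hβ, Real.sq_sqrt (by linarith)]
    exact_mod_cast congrArg (fun x : ℝ => (x : ℂ)) h
  rw [hα', hβ']
  constructor
  · ext ⟨z₂, z₃, w₄, w₅⟩
    simp only [Set.mem_ofPred_eq]
    constructor
    · rintro ⟨w₀, w₁, h0, hinf⟩
      linear_combination 4*hinf - 2*h0
    · intro h
      refine ⟨-(z₂^2 + z₃^2 + w₄*w₅), 1, ?_, by ring⟩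
      linear_combination (-1/2 : ℂ)*h
  · ext ⟨w₀, w₁, z₂, z₃⟩
    simp only [Set.mem_ofPred_eq]
    constructor
    · rintro ⟨w₄, w₅, h0, hinf⟩
      linear_combination 2*h0 - 2*hinf
    · intro h
      refine ⟨-(w₀*w₁ + z₂^2 + z₃^2), 1, ?_, by ring⟩
      linear_combination (1/2 : ℂ)*h
end

section
/- Fix λ ∈ ℝ with 3/2 < λ < 2. A nonzero vector v ∈ Z̃ has ℂ-linearly dependent gradients ∇h₀(v) and ∇h_∞(v) (i.e. v lies over a singular point of the intersection of the two quadrics) if and only if v is a nonzero scalar multiple of one of the four vectors (1,0,0,0,0,0), (0,1,0,0,0,0), (0,0,0,0,1,0), (0,0,0,0,0,1). Equivalently, the singular locus of the intersection of the two quadrics consists exactly of the four points P₁ = [1:0:0:0:0:0], P̄₁ = [0:1:0:0:0:0], P₃ = [0:0:0:0:1:0], P̄₃ = [0:0:0:0:0:1]. -/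
open Complex

/-- `h₀ = 2w₀w₁ + λz₂² + (3/2)z₃² + w₄w₅` on `ℂ⁶`. -/
noncomputable def h0 (lam : ℝ) (v : Fin 6 → ℂ) : ℂ :=
  2*v 0*v 1 + (lam : ℂ)*(v 2)^2 + (3/2 : ℂ)*(v 3)^2 + v 4*v 5

/-- `h_∞ = w₀w₁ + z₂² + z₃² + w₄w₅` on `ℂ⁶`. -/
def hInf (v : Fin 6 → ℂ) : ℂ :=
  v 0*v 1 + (v 2)^2 + (v 3)^2 + v 4*v 5

/-- The gradient of `h₀`: the vector of its six partial derivatives. -/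
noncomputable def gradH0 (lam : ℝ) (v : Fin 6 → ℂ) : Fin 6 → ℂ :=
  ![2*v 1, 2*v 0, 2*(lam : ℂ)*v 2, 3*v 3, v 5, v 4]

/-- The gradient of `h_∞`: the vector of its six partial derivatives. -/
def gradHInf (v : Fin 6 → ℂ) : Fin 6 → ℂ :=
  ![v 1, v 0, 2*v 2, 2*v 3, v 5, v 4]

/-- A nonzero point `v` of the affine cone `Z̃ = {h₀ = h_∞ = 0}` has linearly dependent
gradients `∇h₀(v)`, `∇h_∞(v)` (i.e. lies over a singular point of the intersection of the
two quadrics) if and only if `v` is a nonzero scalar multiple of one of the four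
coordinate vectors `e₀, e₁, e₄, e₅`; i.e. the singular locus of the intersection of the
two quadrics consists exactly of the four points `P₁, P̄₁, P₃, P̄₃`. -/
theorem stmt_8 (lam : ℝ) (h₁ : 3/2 < lam) (h₂ : lam < 2)
    (v : Fin 6 → ℂ) (hv : v ≠ 0) (hv0 : h0 lam v = 0) (hvInf : hInf v = 0) :
    (∃ s t : ℂ, (s, t) ≠ (0, 0) ∧ s • gradH0 lam v + t • gradHInf v = 0) ↔
    (∃ t : ℂ, t ≠ 0 ∧
      (v = t • ![(1 : ℂ), 0, 0, 0, 0, 0] ∨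
       v = t • ![(0 : ℂ), 1, 0, 0, 0, 0] ∨
       v = t • ![(0 : ℂ), 0, 0, 0, 1, 0] ∨
       v = t • ![(0 : ℂ), 0, 0, 0, 0, 1])) := by
  have hs2 : (lam : ℂ) - 2 ≠ 0 := by
    exact_mod_cast (sub_neg.2 h₂).ne
  have hs32 : 2 * (lam : ℂ) - 3 ≠ 0 := by
    exact_mod_cast (show (0 : ℝ) < 2 * lam - 3 by linarith).ne'
  have hs1 : (lam : ℂ) - 1 ≠ 0 := by
    exact_mod_cast (show (0 : ℝ) < lam - 1 by linarith).ne'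
  constructor
  · rintro ⟨s, t, hst, h⟩
    have e (i : Fin 6) := congrFun h i
    have e0 : (2 * s + t) * v 1 = 0 := by
      have := e 0; simp [gradH0, gradHInf] at this; linear_combination this
    have e1 : (2 * s + t) * v 0 = 0 := by
      have := e 1; simp [gradH0, gradHInf] at this; linear_combination this
    have e2 : (lam * s + t) * v 2 = 0 := by
      have := e 2; simp [gradH0, gradHInf] at this; linear_combination this / 2
    have e3 : (3 * s + 2 * t) * v 3 = 0 := by
      have := e 3; simp [gradH0, gradHInf] at this; linear_combination this
    have e4 : (s + t) * v 5 = 0 := by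
      have := e 4; simp [gradH0, gradHInf] at this; linear_combination this
    have e5 : (s + t) * v 4 = 0 := by
      have := e 5; simp [gradH0, gradHInf] at this; linear_combination this
    have hs : s ≠ 0 := by
      rintro rfl
      have ht : t ≠ 0 := by rintro rfl; exact hst rfl
      refine hv (funext fun i => ?_)
      fin_cases i <;> simp_all
    unfold hInf at hvInf
    by_cases c0 : 2 * s + t = 0
    · have z2 : v 2 = 0 := (mul_eq_zero.1 e2).resolve_left fun hc =>
        mul_ne_zero hs2 hs (by linear_combination hc - c0)
      have z3 : v 3 = 0 := (mul_eq_zero.1 e3).resolve_left fun hc =>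
        hs (by linear_combination 2 * c0 - hc)
      have z5 : v 5 = 0 := (mul_eq_zero.1 e4).resolve_left fun hc =>
        hs (by linear_combination c0 - hc)
      have z4 : v 4 = 0 := (mul_eq_zero.1 e5).resolve_left fun hc =>
        hs (by linear_combination c0 - hc)
      have hp : v 0 * v 1 = 0 := by simpa [z2, z3, z4, z5] using hvInf
      rcases mul_eq_zero.1 hp with z | z
      · have hw : v = v 1 • ![(0 : ℂ), 1, 0, 0, 0, 0] := by
          funext i; fin_cases i <;> simp [z, z2, z3, z4, z5]
        exact ⟨v 1, fun h1 => hv (by rw [hw, h1, zero_smul]), .inr (.inl hw)⟩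
      · have hw : v = v 0 • ![(1 : ℂ), 0, 0, 0, 0, 0] := by
          funext i; fin_cases i <;> simp [z, z2, z3, z4, z5]
        exact ⟨v 0, fun h1 => hv (by rw [hw, h1, zero_smul]), .inl hw⟩
    · have z1 : v 1 = 0 := (mul_eq_zero.1 e0).resolve_left c0
      have z0 : v 0 = 0 := (mul_eq_zero.1 e1).resolve_left c0
      by_cases c4 : s + t = 0
      · have z2 : v 2 = 0 := (mul_eq_zero.1 e2).resolve_left fun hc =>
          mul_ne_zero hs1 hs (by linear_combination hc - c4)
        have z3 : v 3 = 0 := (mul_eq_zero.1 e3).resolve_left fun hc =>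
          hs (by linear_combination hc - 2 * c4)
        have hp : v 4 * v 5 = 0 := by simpa [z0, z1, z2, z3] using hvInf
        rcases mul_eq_zero.1 hp with z | z
        · have hw : v = v 5 • ![(0 : ℂ), 0, 0, 0, 0, 1] := by
            funext i; fin_cases i <;> simp [z, z0, z1, z2, z3]
          exact ⟨v 5, fun h1 => hv (by rw [hw, h1, zero_smul]), .inr (.inr (.inr hw))⟩
        · have hw : v = v 4 • ![(0 : ℂ), 0, 0, 0, 1, 0] := by
            funext i; fin_cases i <;> simp [z, z0, z1, z2, z3]
          exact ⟨v 4, fun h1 => hv (by rw [hw, h1, zero_smul]), .inr (.inr (.inl hw))⟩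
      · have z5 : v 5 = 0 := (mul_eq_zero.1 e4).resolve_left c4
        have z4 : v 4 = 0 := (mul_eq_zero.1 e5).resolve_left c4
        have hsq : v 2 ^ 2 + v 3 ^ 2 = 0 := by simpa [z0, z1, z4, z5] using hvInf
        have hz : v 2 = 0 ∧ v 3 = 0 := by
          rcases mul_eq_zero.1 e2 with c2 | z2
          · have z3 : v 3 = 0 := (mul_eq_zero.1 e3).resolve_left fun hc =>
              mul_ne_zero hs32 hs (by linear_combination 2 * c2 - hc)
            exact ⟨by simpa [z3] using hsq, z3⟩
          · exact ⟨z2, by simpa [z2] using hsq⟩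
        refine absurd (funext fun i => ?_) hv
        fin_cases i <;> simp [z0, z1, hz.1, hz.2, z4, z5]
  · rintro ⟨t, -, rfl | rfl | rfl | rfl⟩
    · refine ⟨1, -2, by simp, funext fun i => ?_⟩
      fin_cases i <;> simp [gradH0, gradHInf]
    · refine ⟨1, -2, by simp, funext fun i => ?_⟩
      fin_cases i <;> simp [gradH0, gradHInf]
    · refine ⟨1, -1, by simp, funext fun i => ?_⟩
      fin_cases i <;> simp [gradH0, gradHInf]
    · refine ⟨1, -1, by simp, funext fun i => ?_⟩
      fin_cases i <;> simp [gradH0, gradHInf]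
end

section
/- Fix λ ∈ ℝ with 3/2 < λ < 2 and set α = √(4 − 2λ), β = √(2λ − 2). Let U ∈ GL(6,ℂ) have block form [[A₁₁, A₁₂, O],[O, A₂₂, O],[O, A₃₂, A₃₃]] with respect to the grouping of coordinates (w₀,w₁),(z₂,z₃),(w₄,w₅), where A₁₁ equals diag(a, conj(a)) or the antidiagonal matrix with entries a, conj(a), and A₃₃ equals diag(b, conj(b)) or the antidiagonal matrix with entries b, conj(b), for some nonzero a, b ∈ ℂ. Suppose U commutes with σ, U maps T₁ ∪ T₂ onto T₁ ∪ T₂, and U maps T₃ ∪ T₄ onto T₃ ∪ T₄. Then A₁₂ = O, A₃₂ = O, and there exists a nonzero real number c such that A₂₂ = c·I₂ or A₂₂ = c·diag(1,−1). -/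
open Complex ComplexConjugate

/-- The real structure on `ℂ⁶`:
`σ(w₀,w₁,z₂,z₃,w₄,w₅) = (conj w₁, conj w₀, conj z₂, −conj z₃, −conj w₅, −conj w₄)`. -/
def sigma6 (v : Fin 6 → ℂ) : Fin 6 → ℂ :=
  ![conj (v 1), conj (v 0), conj (v 2), -conj (v 3), -conj (v 5), -conj (v 4)]

/-- The cone over the torus-invariant conic `T₁`. -/
def T1 (lam α : ℝ) : Set (Fin 6 → ℂ) :=
  {v | (α : ℂ)*v 2 - I*v 3 = 0 ∧ v 4 = 0 ∧ v 5 = 0 ∧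
       v 0*v 1 + (2*(lam : ℂ) - 3)*(v 2)^2 = 0}

/-- The cone over the torus-invariant conic `T₂`. -/
def T2 (lam α : ℝ) : Set (Fin 6 → ℂ) :=
  {v | (α : ℂ)*v 2 + I*v 3 = 0 ∧ v 4 = 0 ∧ v 5 = 0 ∧
       v 0*v 1 + (2*(lam : ℂ) - 3)*(v 2)^2 = 0}

/-- The cone over the torus-invariant conic `T₃`. -/
def T3 (lam β : ℝ) : Set (Fin 6 → ℂ) :=
  {v | (β : ℂ)*v 2 - I*v 3 = 0 ∧ v 0 = 0 ∧ v 1 = 0 ∧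
       (3 - 2*(lam : ℂ))*(v 2)^2 + v 4*v 5 = 0}

/-- The cone over the torus-invariant conic `T₄`. -/
def T4 (lam β : ℝ) : Set (Fin 6 → ℂ) :=
  {v | (β : ℂ)*v 2 + I*v 3 = 0 ∧ v 0 = 0 ∧ v 1 = 0 ∧
       (3 - 2*(lam : ℂ))*(v 2)^2 + v 4*v 5 = 0}

theorem mem_T1_union_T2_iff (lam α : ℝ) (v : Fin 6 → ℂ) :
    v ∈ T1 lam α ∪ T2 lam α ↔ v 4 = 0 ∧ v 5 = 0 ∧
      v 0 * v 1 + (2 * (lam : ℂ) - 3) * v 2 ^ 2 = 0 ∧ (α : ℂ) ^ 2 * v 2 ^ 2 + v 3 ^ 2 = 0 := by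
  have key : (α : ℂ) ^ 2 * v 2 ^ 2 + v 3 ^ 2 = (α * v 2 - I * v 3) * (α * v 2 + I * v 3) := by
    linear_combination v 3 ^ 2 * I_sq
  rw [key, mul_eq_zero]
  simp only [T1, T2, Set.mem_union, Set.mem_ofPred_eq]
  tauto

theorem mem_T3_union_T4_iff (lam β : ℝ) (v : Fin 6 → ℂ) :
    v ∈ T3 lam β ∪ T4 lam β ↔ v 0 = 0 ∧ v 1 = 0 ∧
      (3 - 2 * (lam : ℂ)) * v 2 ^ 2 + v 4 * v 5 = 0 ∧ (β : ℂ) ^ 2 * v 2 ^ 2 + v 3 ^ 2 = 0 := by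
  have key : (β : ℂ) ^ 2 * v 2 ^ 2 + v 3 ^ 2 = (β * v 2 - I * v 3) * (β * v 2 + I * v 3) := by
    linear_combination v 3 ^ 2 * I_sq
  rw [key, mul_eq_zero]
  simp only [T3, T4, Set.mem_union, Set.mem_ofPred_eq]
  tauto

/-- If `x + y t` and `x - y t` both vanish for some `t ≠ 0`, then `x = y = 0`. -/
theorem eq_zero_and_eq_zero_of_add_mul_eq_zero {x y t : ℂ} (ht : t ≠ 0)
    (h : x + y * t = 0) (hneg : x + y * -t = 0) : x = 0 ∧ y = 0 := by
  have hx : x = 0 := by linear_combination (h + hneg) / 2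
  refine ⟨hx, ?_⟩
  have : y * t = 0 := by linear_combination h - hx
  exact (mul_eq_zero.mp this).resolve_right ht

/-- If `(x + y t)²` and `(x - y t)²` are both equal to `A`, then `x y = 0` and `x² + y² t² = A`. -/
theorem mul_eq_zero_and_sq_add_sq_eq {x y t A : ℂ} (ht : t ≠ 0)
    (h : (x + y * t) ^ 2 = A) (hneg : (x + y * -t) ^ 2 = A) :
    x * y = 0 ∧ x ^ 2 + y ^ 2 * t ^ 2 = A := by
  constructor
  · have : x * y * t = 0 := by linear_combination (h - hneg) / 4
    exact (mul_eq_zero.mp this).resolve_right ht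
  · linear_combination (h + hneg) / 2

/-- A `2 × 2` block which, up to the scalars `A` and `B`, preserves the two pairs of lines
`z₃² = s z₂²` and `z₃² = t z₂²`, is diagonal with entries equal up to sign. -/
theorem diagonal_of_preserves_line_pairs {p q r u s t A B : ℂ} (hA : A ≠ 0)
    (hs₀ : s ≠ 0) (ht₀ : t ≠ 0) (hst : s ≠ t) (hst' : s + t ≠ 0) (hpq : p * q = 0) (hru : r * u = 0)
    (h₁ : p ^ 2 + q ^ 2 * s = A) (h₂ : p ^ 2 + q ^ 2 * t = B)
    (h₃ : r ^ 2 + u ^ 2 * s = s * A) (h₄ : r ^ 2 + u ^ 2 * t = t * B) :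
    q = 0 ∧ r = 0 ∧ p ^ 2 = A ∧ u ^ 2 = A := by
  have hst₀ : s - t ≠ 0 := sub_ne_zero.mpr hst
  rcases mul_eq_zero.mp hpq with rfl | rfl <;> rcases mul_eq_zero.mp hru with rfl | rfl
  · exfalso
    have huA : u ^ 2 = A := mul_right_cancel₀ hs₀ (by linear_combination h₃)
    have huB : u ^ 2 = B := mul_right_cancel₀ ht₀ (by linear_combination h₄)
    have : q ^ 2 * (s - t) = 0 := by linear_combination h₁ - h₂ + huB - huA
    have hq : q ^ 2 = 0 := (mul_eq_zero.mp this).resolve_right hst₀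
    exact hA (by linear_combination -h₁ + s * hq)
  · exfalso
    have : q ^ 2 * ((s - t) * (s + t)) = 0 := by
      linear_combination s * h₁ - t * h₂ - h₃ + h₄
    have hq : q ^ 2 = 0 := (mul_eq_zero.mp this).resolve_right (mul_ne_zero hst₀ hst')
    exact hA (by linear_combination -h₁ + s * hq)
  · have hAB : A = B := by linear_combination h₂ - h₁
    have : (u ^ 2 - A) * (s - t) = 0 := by linear_combination h₃ - h₄ + t * hAB
    have hu : u ^ 2 - A = 0 := (mul_eq_zero.mp this).resolve_right hst₀
    exact ⟨rfl, rfl, by linear_combination h₁, by linear_combination hu⟩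
  · exfalso
    have : A * (s - t) = 0 := by linear_combination h₄ - h₃ - t * (h₂ - h₁)
    exact hA ((mul_eq_zero.mp this).resolve_right hst₀)

/-- Case (I): an invertible `U` with block form `[[A₁₁,A₁₂,O],[O,A₂₂,O],[O,A₃₂,A₃₃]]`,
`A₁₁`, `A₃₃` diagonal or antidiagonal of the indicated conjugate form, commuting with the
real structure `σ` and preserving each of the sets `T₁ ∪ T₂` and `T₃ ∪ T₄`, must have
`A₁₂ = A₃₂ = O` and `A₂₂ = c·I₂` or `A₂₂ = c·diag(1,−1)` for some nonzero real `c`. -/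
theorem stmt_9 (lam α β : ℝ) (h₁ : 3/2 < lam) (h₂ : lam < 2)
    (hα : α = Real.sqrt (4 - 2*lam)) (hβ : β = Real.sqrt (2*lam - 2))
    (U : Matrix (Fin 6) (Fin 6) ℂ) (hU : IsUnit U.det)
    (a b : ℂ) (ha : a ≠ 0) (hb : b ≠ 0)
    (hblock1 : ∀ i j : Fin 6, (i = 0 ∨ i = 1) → (j = 4 ∨ j = 5) → U i j = 0)
    (hblock2 : ∀ i j : Fin 6, (i = 2 ∨ i = 3) → (j = 0 ∨ j = 1 ∨ j = 4 ∨ j = 5) → U i j = 0)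
    (hblock3 : ∀ i j : Fin 6, (i = 4 ∨ i = 5) → (j = 0 ∨ j = 1) → U i j = 0)
    (hA11 : (U 0 0 = a ∧ U 1 1 = conj a ∧ U 0 1 = 0 ∧ U 1 0 = 0) ∨
            (U 0 1 = a ∧ U 1 0 = conj a ∧ U 0 0 = 0 ∧ U 1 1 = 0))
    (hA33 : (U 4 4 = b ∧ U 5 5 = conj b ∧ U 4 5 = 0 ∧ U 5 4 = 0) ∨
            (U 4 5 = b ∧ U 5 4 = conj b ∧ U 4 4 = 0 ∧ U 5 5 = 0))
    (hcomm : ∀ v : Fin 6 → ℂ, U.mulVec (sigma6 v) = sigma6 (U.mulVec v))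
    (h12 : U.mulVec '' (T1 lam α ∪ T2 lam α) = T1 lam α ∪ T2 lam α)
    (h34 : U.mulVec '' (T3 lam β ∪ T4 lam β) = T3 lam β ∪ T4 lam β) :
    (U 0 2 = 0 ∧ U 0 3 = 0 ∧ U 1 2 = 0 ∧ U 1 3 = 0) ∧
    (U 4 2 = 0 ∧ U 4 3 = 0 ∧ U 5 2 = 0 ∧ U 5 3 = 0) ∧
    (∃ c : ℝ, c ≠ 0 ∧
      ((U 2 2 = (c : ℂ) ∧ U 2 3 = 0 ∧ U 3 2 = 0 ∧ U 3 3 = (c : ℂ)) ∨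
       (U 2 2 = (c : ℂ) ∧ U 2 3 = 0 ∧ U 3 2 = 0 ∧ U 3 3 = -(c : ℂ)))) := by
  have hμ : (2 * (lam : ℂ) - 3) ≠ 0 := by
    have : (2 * lam - 3 : ℝ) ≠ 0 := by linarith
    exact_mod_cast this
  have hα2 : (α : ℂ) ^ 2 = 4 - 2 * lam := by
    have : α ^ 2 = 4 - 2 * lam := by rw [hα, Real.sq_sqrt (by linarith)]
    exact_mod_cast this
  have hβ2 : (β : ℂ) ^ 2 = 2 * lam - 2 := by
    have : β ^ 2 = 2 * lam - 2 := by rw [hβ, Real.sq_sqrt (by linarith)]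
    exact_mod_cast this
  have hα0 : (α : ℂ) ≠ 0 := by
    have : α ≠ 0 := by rw [hα]; exact (Real.sqrt_pos.mpr (by linarith)).ne'
    exact_mod_cast this
  have hβ0 : (β : ℂ) ≠ 0 := by
    have : β ≠ 0 := by rw [hβ]; exact (Real.sqrt_pos.mpr (by linarith)).ne'
    exact_mod_cast this
  have hIα : I * (α : ℂ) ≠ 0 := mul_ne_zero I_ne_zero hα0
  have hIβ : I * (β : ℂ) ≠ 0 := mul_ne_zero I_ne_zero hβ0
  have hIα2 : (I * (α : ℂ)) ^ 2 = -(α : ℂ) ^ 2 := by rw [mul_pow, I_sq]; ring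
  have hIβ2 : (I * (β : ℂ)) ^ 2 = -(β : ℂ) ^ 2 := by rw [mul_pow, I_sq]; ring
  have image12 : ∀ e : ℂ, e ^ 2 = -(α : ℂ) ^ 2 →
      U.mulVec ![1, -(2 * (lam : ℂ) - 3), 1, e, 0, 0] ∈ T1 lam α ∪ T2 lam α := by
    intro e he
    rw [← h12]
    refine Set.mem_image_of_mem _ ((mem_T1_union_T2_iff _ _ _).mpr ⟨rfl, rfl, ?_, ?_⟩)
    · simp
    · simp [he]
  have image34 : ∀ e : ℂ, e ^ 2 = -(β : ℂ) ^ 2 →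
      U.mulVec ![0, 0, 1, e, 1, 2 * (lam : ℂ) - 3] ∈ T3 lam β ∪ T4 lam β := by
    intro e he
    rw [← h34]
    refine Set.mem_image_of_mem _ ((mem_T3_union_T4_iff _ _ _).mpr ⟨rfl, rfl, ?_, ?_⟩)
    · simp
    · simp [he]
  have u04 := hblock1 0 4 (by decide) (by decide)
  have u05 := hblock1 0 5 (by decide) (by decide)
  have u14 := hblock1 1 4 (by decide) (by decide)
  have u15 := hblock1 1 5 (by decide) (by decide)
  have u20 := hblock2 2 0 (by decide) (by decide)
  have u21 := hblock2 2 1 (by decide) (by decide)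
  have u24 := hblock2 2 4 (by decide) (by decide)
  have u25 := hblock2 2 5 (by decide) (by decide)
  have u30 := hblock2 3 0 (by decide) (by decide)
  have u31 := hblock2 3 1 (by decide) (by decide)
  have u34 := hblock2 3 4 (by decide) (by decide)
  have u35 := hblock2 3 5 (by decide) (by decide)
  have u40 := hblock3 4 0 (by decide) (by decide)
  have u41 := hblock3 4 1 (by decide) (by decide)
  have u50 := hblock3 5 0 (by decide) (by decide)
  have u51 := hblock3 5 1 (by decide) (by decide)
  have eqs12 : ∀ e : ℂ, e ^ 2 = -(α : ℂ) ^ 2 →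
      U 4 2 + U 4 3 * e = 0 ∧ U 5 2 + U 5 3 * e = 0 ∧
      (U 0 0 + U 0 1 * -(2 * (lam : ℂ) - 3) + U 0 2 + U 0 3 * e) *
        (U 1 0 + U 1 1 * -(2 * (lam : ℂ) - 3) + U 1 2 + U 1 3 * e) +
        (2 * (lam : ℂ) - 3) * (U 2 2 + U 2 3 * e) ^ 2 = 0 ∧
      (α : ℂ) ^ 2 * (U 2 2 + U 2 3 * e) ^ 2 + (U 3 2 + U 3 3 * e) ^ 2 = 0 := by
    intro e he
    have h := (mem_T1_union_T2_iff _ _ _).mp (image12 e he)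
    simpa [-neg_sub, Matrix.mulVec, dotProduct, Fin.sum_univ_six, u20, u21, u30, u31, u40, u41,
      u50, u51] using h
  have eqs34 : ∀ e : ℂ, e ^ 2 = -(β : ℂ) ^ 2 →
      U 0 2 + U 0 3 * e = 0 ∧ U 1 2 + U 1 3 * e = 0 ∧
      (3 - 2 * (lam : ℂ)) * (U 2 2 + U 2 3 * e) ^ 2 +
      (U 4 2 + U 4 3 * e + U 4 4 + U 4 5 * (2 * (lam : ℂ) - 3)) *
        (U 5 2 + U 5 3 * e + U 5 4 + U 5 5 * (2 * (lam : ℂ) - 3)) = 0 ∧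
      (β : ℂ) ^ 2 * (U 2 2 + U 2 3 * e) ^ 2 + (U 3 2 + U 3 3 * e) ^ 2 = 0 := by
    intro e he
    have h := (mem_T3_union_T4_iff _ _ _).mp (image34 e he)
    simpa [Matrix.mulVec, dotProduct, Fin.sum_univ_six, u04, u05, u14, u15, u24, u25, u34, u35]
      using h
  obtain ⟨p4, p5, pq, pz⟩ := eqs12 (I * α) hIα2
  obtain ⟨m4, m5, mq, mz⟩ := eqs12 (-(I * α)) (by rw [neg_sq, hIα2])
  obtain ⟨p0, p1, pq', pz'⟩ := eqs34 (I * β) hIβ2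
  obtain ⟨m0, m1, mq', mz'⟩ := eqs34 (-(I * β)) (by rw [neg_sq, hIβ2])
  obtain ⟨u42, u43⟩ := eq_zero_and_eq_zero_of_add_mul_eq_zero hIα p4 m4
  obtain ⟨u52, u53⟩ := eq_zero_and_eq_zero_of_add_mul_eq_zero hIα p5 m5
  obtain ⟨u02, u03⟩ := eq_zero_and_eq_zero_of_add_mul_eq_zero hIβ p0 m0
  obtain ⟨u12, u13⟩ := eq_zero_and_eq_zero_of_add_mul_eq_zero hIβ p1 m1
  refine ⟨⟨u02, u03, u12, u13⟩, ⟨u42, u43, u52, u53⟩, ?_⟩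
  have hA : (U 0 0 + U 0 1 * -(2 * (lam : ℂ) - 3)) * (U 1 0 + U 1 1 * -(2 * (lam : ℂ) - 3)) =
      -(2 * (lam : ℂ) - 3) * (a * conj a) := by
    rcases hA11 with ⟨e₁, e₂, e₃, e₄⟩ | ⟨e₁, e₂, e₃, e₄⟩ <;> rw [e₁, e₂, e₃, e₄] <;> ring
  have hB : (U 4 4 + U 4 5 * (2 * (lam : ℂ) - 3)) * (U 5 4 + U 5 5 * (2 * (lam : ℂ) - 3)) =
      (2 * (lam : ℂ) - 3) * (b * conj b) := by
    rcases hA33 with ⟨e₁, e₂, e₃, e₄⟩ | ⟨e₁, e₂, e₃, e₄⟩ <;> rw [e₁, e₂, e₃, e₄] <;> ring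
  simp only [u02, u03, u12, u13, zero_mul, add_zero] at pq mq
  simp only [u42, u43, u52, u53, zero_mul, zero_add] at pq' mq'
  have pA : (U 2 2 + U 2 3 * (I * α)) ^ 2 = a * conj a :=
    mul_left_cancel₀ hμ (by linear_combination pq - hA)
  have mA : (U 2 2 + U 2 3 * -(I * α)) ^ 2 = a * conj a :=
    mul_left_cancel₀ hμ (by linear_combination mq - hA)
  have pB : (U 2 2 + U 2 3 * (I * β)) ^ 2 = b * conj b :=
    mul_left_cancel₀ hμ (by linear_combination hB - pq')
  have mB : (U 2 2 + U 2 3 * -(I * β)) ^ 2 = b * conj b :=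
    mul_left_cancel₀ hμ (by linear_combination hB - mq')
  rw [pA] at pz
  rw [mA] at mz
  rw [pB] at pz'
  rw [mB] at mz'
  obtain ⟨hpq, e₁⟩ := mul_eq_zero_and_sq_add_sq_eq hIα pA mA
  obtain ⟨-, e₂⟩ := mul_eq_zero_and_sq_add_sq_eq hIβ pB mB
  obtain ⟨hru, e₃⟩ := mul_eq_zero_and_sq_add_sq_eq
    (x := U 3 2) (y := U 3 3) (A := -(α : ℂ) ^ 2 * (a * conj a)) hIα
    (by linear_combination pz) (by linear_combination mz)
  obtain ⟨-, e₄⟩ := mul_eq_zero_and_sq_add_sq_eq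
    (x := U 3 2) (y := U 3 3) (A := -(β : ℂ) ^ 2 * (b * conj b)) hIβ
    (by linear_combination pz') (by linear_combination mz')
  rw [hIα2] at e₁ e₃
  rw [hIβ2] at e₂ e₄
  have hane : a * conj a ≠ 0 := mul_ne_zero ha ((map_ne_zero _).mpr ha)
  obtain ⟨u23, u32, hp, hs⟩ := diagonal_of_preserves_line_pairs hane
    (neg_ne_zero.mpr (pow_ne_zero 2 hα0)) (neg_ne_zero.mpr (pow_ne_zero 2 hβ0))
    (fun h => hμ (by linear_combination (h + hα2 - hβ2) / 2))
    (by rw [hα2, hβ2]; ring_nf; norm_num) hpq hru e₁ e₂ e₃ e₄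
  have hreal : conj (U 2 2) = U 2 2 := by
    have h := congrFun (hcomm ![0, 0, 1, 0, 0, 0]) 2
    simpa [sigma6, Matrix.mulVec, dotProduct, Fin.sum_univ_six] using h.symm
  obtain ⟨c, hc⟩ := conj_eq_iff_real.mp hreal
  refine ⟨c, ?_, ?_⟩
  · rintro rfl
    exact hane (by rw [← hp, hc]; simp)
  · rcases sq_eq_sq_iff_eq_or_eq_neg.mp (hs.trans hp.symm) with h | h
    · exact Or.inl ⟨hc, u23, u32, h.trans hc⟩
    · exact Or.inr ⟨hc, u23, u32, by rw [h, hc]⟩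
end

section
/- Fix λ ∈ ℝ with 3/2 < λ < 2 and set α = √(4 − 2λ), β = √(2λ − 2). Let U ∈ GL(6,ℂ) have block form [[O, A₁₂, A₁₃],[O, A₂₂, O],[A₃₁, A₃₂, O]] with respect to the grouping of coordinates (w₀,w₁),(z₂,z₃),(w₄,w₅), where A₁₃ equals diag(a, −conj(a)) or the antidiagonal matrix with entries a, −conj(a), and A₃₁ equals diag(b, −conj(b)) or the antidiagonal matrix with entries b, −conj(b), for some nonzero a, b ∈ ℂ. Suppose U commutes with σ, U maps T₁ ∪ T₂ onto T₃ ∪ T₄, and U maps T₃ ∪ T₄ onto T₁ ∪ T₂. Then A₁₂ = O, A₃₂ = O, and there exists a nonzero purely imaginary number c such that A₂₂ = c·[[0,1],[αβ,0]] or A₂₂ = c·[[0,−1],[αβ,0]]. -/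
open Complex ComplexConjugate

/-- Defining equations satisfied on `T₁ ∪ T₂`, with the two linear factors multiplied. -/
theorem eqs_of_mem_T1_union_T2 {lam α : ℝ} {v : Fin 6 → ℂ} (h : v ∈ T1 lam α ∪ T2 lam α) :
    (α : ℂ)^2*(v 2)^2 + (v 3)^2 = 0 ∧ v 4 = 0 ∧ v 5 = 0 := by
  rcases h with ⟨h, h4, h5, -⟩ | ⟨h, h4, h5, -⟩
  · exact ⟨by linear_combination ((α : ℂ)*v 2 + I*v 3)*h + (v 3)^2*I_sq, h4, h5⟩
  · exact ⟨by linear_combination ((α : ℂ)*v 2 - I*v 3)*h + (v 3)^2*I_sq, h4, h5⟩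

/-- Defining equations satisfied on `T₃ ∪ T₄`, with the two linear factors multiplied. -/
theorem eqs_of_mem_T3_union_T4 {lam β : ℝ} {v : Fin 6 → ℂ} (h : v ∈ T3 lam β ∪ T4 lam β) :
    (β : ℂ)^2*(v 2)^2 + (v 3)^2 = 0 ∧ v 0 = 0 ∧ v 1 = 0 ∧
      (3 - 2*(lam : ℂ))*(v 2)^2 + v 4*v 5 = 0 := by
  rcases h with ⟨h, h0, h1, h2⟩ | ⟨h, h0, h1, h2⟩
  · exact ⟨by linear_combination ((β : ℂ)*v 2 + I*v 3)*h + (v 3)^2*I_sq, h0, h1, h2⟩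
  · exact ⟨by linear_combination ((β : ℂ)*v 2 - I*v 3)*h + (v 3)^2*I_sq, h0, h1, h2⟩

/-- Real form of the condition that the matrix `[[s, iτ], [iμ, ν]]` sends `(1, -iδ)` into the line
pair of slopes `±γ`. -/
theorem sq_eq_sq_of_complex_slopes {γ δ s τ μ ν : ℝ}
    (h : (γ : ℂ)^2*(s + I*τ*(-I*δ))^2 + (I*μ + ν*(-I*δ))^2 = 0) :
    γ^2*(s + δ*τ)^2 = (μ - δ*ν)^2 := by
  have : (γ : ℂ)^2*(s + δ*τ)^2 = (μ - δ*ν)^2 := by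
    linear_combination
      h + ((γ : ℂ)^2*δ*τ*(s + δ*τ + (s + I*τ*(-I*δ))) - ((μ : ℂ) - δ*ν)^2)*I_sq
  exact_mod_cast this

/-- A real `2 × 2` system: the conditions that `[[s, τ], [μ, ν]]` exchange the line pairs of
slopes `±α` and `±β` force it to be antidiagonal. -/
theorem antidiagonal_of_swap_slopes {α β s τ μ ν : ℝ} (hne : α^2 ≠ β^2)
    (h1 : β^2*(s + α*τ)^2 = (μ - α*ν)^2) (h2 : β^2*(s - α*τ)^2 = (μ + α*ν)^2)
    (h3 : α^2*(s + β*τ)^2 = (μ - β*ν)^2) (h4 : α^2*(s - β*τ)^2 = (μ + β*ν)^2) :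
    s = 0 ∧ ν = 0 ∧ (μ = α*β*τ ∨ μ = -(α*β*τ)) := by
  have h : s^2 + ν^2 = 0 := by
    apply mul_left_cancel₀ (sub_ne_zero.mpr hne)
    linear_combination (h3 + h4 - h1 - h2)/2
  have hs : s = 0 := by nlinarith [sq_nonneg s, sq_nonneg ν]
  have hν : ν = 0 := by nlinarith [sq_nonneg s, sq_nonneg ν]
  refine ⟨hs, hν, sq_eq_sq_iff_eq_or_eq_neg.mp ?_⟩
  subst hs hν
  linear_combination -h1

/-- Case (II): an invertible `U` with block form `[[O,A₁₂,A₁₃],[O,A₂₂,O],[A₃₁,A₃₂,O]]`,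
`A₁₃`, `A₃₁` diagonal or antidiagonal of the indicated conjugate form, commuting with the
real structure `σ` and interchanging the sets `T₁ ∪ T₂` and `T₃ ∪ T₄`, must have
`A₁₂ = A₃₂ = O` and `A₂₂ = c·[[0,1],[αβ,0]]` or `A₂₂ = c·[[0,−1],[αβ,0]]` for some
nonzero purely imaginary `c`. -/
theorem stmt_10 (lam α β : ℝ) (h₁ : 3/2 < lam) (h₂ : lam < 2)
    (hα : α = Real.sqrt (4 - 2*lam)) (hβ : β = Real.sqrt (2*lam - 2))
    (U : Matrix (Fin 6) (Fin 6) ℂ) (hU : IsUnit U.det)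
    (a b : ℂ) (ha : a ≠ 0) (hb : b ≠ 0)
    (hblock1 : ∀ i j : Fin 6, (i = 0 ∨ i = 1) → (j = 0 ∨ j = 1) → U i j = 0)
    (hblock2 : ∀ i j : Fin 6, (i = 2 ∨ i = 3) → (j = 0 ∨ j = 1 ∨ j = 4 ∨ j = 5) → U i j = 0)
    (hblock3 : ∀ i j : Fin 6, (i = 4 ∨ i = 5) → (j = 4 ∨ j = 5) → U i j = 0)
    (hA13 : (U 0 4 = a ∧ U 1 5 = -conj a ∧ U 0 5 = 0 ∧ U 1 4 = 0) ∨
            (U 0 5 = a ∧ U 1 4 = -conj a ∧ U 0 4 = 0 ∧ U 1 5 = 0))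
    (hA31 : (U 4 0 = b ∧ U 5 1 = -conj b ∧ U 4 1 = 0 ∧ U 5 0 = 0) ∨
            (U 4 1 = b ∧ U 5 0 = -conj b ∧ U 4 0 = 0 ∧ U 5 1 = 0))
    (hcomm : ∀ v : Fin 6 → ℂ, U.mulVec (sigma6 v) = sigma6 (U.mulVec v))
    (h12 : U.mulVec '' (T1 lam α ∪ T2 lam α) = T3 lam β ∪ T4 lam β)
    (h34 : U.mulVec '' (T3 lam β ∪ T4 lam β) = T1 lam α ∪ T2 lam α) :
    (U 0 2 = 0 ∧ U 0 3 = 0 ∧ U 1 2 = 0 ∧ U 1 3 = 0) ∧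
    (U 4 2 = 0 ∧ U 4 3 = 0 ∧ U 5 2 = 0 ∧ U 5 3 = 0) ∧
    (∃ c : ℂ, c ≠ 0 ∧ c.re = 0 ∧
      ((U 2 2 = 0 ∧ U 2 3 = c ∧ U 3 2 = c*((α : ℂ)*(β : ℂ)) ∧ U 3 3 = 0) ∨
       (U 2 2 = 0 ∧ U 2 3 = -c ∧ U 3 2 = c*((α : ℂ)*(β : ℂ)) ∧ U 3 3 = 0))) := by
  have hαpos : 0 < α := by rw [hα]; exact Real.sqrt_pos.mpr (by linarith)
  have hβpos : 0 < β := by rw [hβ]; exact Real.sqrt_pos.mpr (by linarith)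
  have hα2 : α^2 = 4 - 2*lam := by rw [hα]; exact Real.sq_sqrt (by linarith)
  have hβ2 : β^2 = 2*lam - 2 := by rw [hβ]; exact Real.sq_sqrt (by linarith)
  have hαC : (α : ℂ) ≠ 0 := by exact_mod_cast hαpos.ne'
  have hβC : (β : ℂ) ≠ 0 := by exact_mod_cast hβpos.ne'
  have hne : α^2 ≠ β^2 := by rw [hα2, hβ2]; intro h; linarith
  have hk : 3 - 2*(lam : ℂ) ≠ 0 := by
    have : 3 - 2*lam ≠ 0 := by linarith
    exact_mod_cast this
  have b00 := hblock1 0 0 (by simp) (by simp)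
  have b01 := hblock1 0 1 (by simp) (by simp)
  have b10 := hblock1 1 0 (by simp) (by simp)
  have b11 := hblock1 1 1 (by simp) (by simp)
  have b20 := hblock2 2 0 (by simp) (by simp)
  have b21 := hblock2 2 1 (by simp) (by simp)
  have b24 := hblock2 2 4 (by simp) (by simp)
  have b25 := hblock2 2 5 (by simp) (by simp)
  have b30 := hblock2 3 0 (by simp) (by simp)
  have b31 := hblock2 3 1 (by simp) (by simp)
  have b34 := hblock2 3 4 (by simp) (by simp)
  have b35 := hblock2 3 5 (by simp) (by simp)
  have b44 := hblock3 4 4 (by simp) (by simp)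
  have b45 := hblock3 4 5 (by simp) (by simp)
  have b54 := hblock3 5 4 (by simp) (by simp)
  have b55 := hblock3 5 5 (by simp) (by simp)
  have expand (v : Fin 6 → ℂ) (i : Fin 6) : U.mulVec v i =
      U i 0*v 0 + U i 1*v 1 + U i 2*v 2 + U i 3*v 3 + U i 4*v 4 + U i 5*v 5 := by
    simp [Matrix.mulVec, dotProduct, Fin.sum_univ_six]
  -- the image under `U` of one point on each of the four cones
  have m1 : ![1, -(2*(lam : ℂ) - 3), 1, -I*α, 0, 0] ∈ T1 lam α ∪ T2 lam α := by
    left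
    exact ⟨by simp only [Matrix.cons_val]; linear_combination (α : ℂ)*I_sq, rfl, rfl,
      by simp only [Matrix.cons_val]; ring⟩
  have m2 : ![1, -(2*(lam : ℂ) - 3), 1, I*α, 0, 0] ∈ T1 lam α ∪ T2 lam α := by
    right
    exact ⟨by simp only [Matrix.cons_val]; linear_combination (α : ℂ)*I_sq, rfl, rfl,
      by simp only [Matrix.cons_val]; ring⟩
  have m3 : ![0, 0, 1, -I*β, 1, 2*(lam : ℂ) - 3] ∈ T3 lam β ∪ T4 lam β := by
    left
    exact ⟨by simp only [Matrix.cons_val]; linear_combination (β : ℂ)*I_sq, rfl, rfl,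
      by simp only [Matrix.cons_val]; ring⟩
  have m4 : ![0, 0, 1, I*β, 1, 2*(lam : ℂ) - 3] ∈ T3 lam β ∪ T4 lam β := by
    right
    exact ⟨by simp only [Matrix.cons_val]; linear_combination (β : ℂ)*I_sq, rfl, rfl,
      by simp only [Matrix.cons_val]; ring⟩
  have e1 := eqs_of_mem_T3_union_T4 (h12 ▸ Set.mem_image_of_mem U.mulVec m1)
  have e2 := eqs_of_mem_T3_union_T4 (h12 ▸ Set.mem_image_of_mem U.mulVec m2)
  have e3 := eqs_of_mem_T1_union_T2 (h34 ▸ Set.mem_image_of_mem U.mulVec m3)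
  have e4 := eqs_of_mem_T1_union_T2 (h34 ▸ Set.mem_image_of_mem U.mulVec m4)
  simp only [expand, Matrix.cons_val, b00, b01, b10, b11, b20, b21, b24, b25, b30, b31, b34, b35,
    b44, b45, b54, b55, zero_mul, mul_zero, mul_one, zero_add, add_zero] at e1 e2 e3 e4
  obtain ⟨e12, e10, e11, e1q⟩ := e1
  obtain ⟨e22, e20, e21, -⟩ := e2
  obtain ⟨e32, e34, e35⟩ := e3
  obtain ⟨e42, e44, e45⟩ := e4
  have vanish {x y γ : ℂ} (hγ : γ ≠ 0) (h : x + y*(-I*γ) = 0) (h' : x + y*(I*γ) = 0) :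
      x = 0 ∧ y = 0 := by
    refine ⟨by linear_combination (h + h')/2, ?_⟩
    have hy : y*(I*γ) = 0 := by linear_combination (h' - h)/2
    exact (mul_eq_zero.mp hy).resolve_right (mul_ne_zero I_ne_zero hγ)
  obtain ⟨u02, u03⟩ := vanish hαC e10 e20
  obtain ⟨u12, u13⟩ := vanish hαC e11 e21
  obtain ⟨u42, u43⟩ := vanish hβC e34 e44
  obtain ⟨u52, u53⟩ := vanish hβC e35 e45
  refine ⟨⟨u02, u03, u12, u13⟩, ⟨u42, u43, u52, u53⟩, ?_⟩
  have hp : U 2 2 + U 2 3*(-I*α) ≠ 0 := by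
    intro hp
    rw [hp, u42, u43, u52, u53] at e1q
    rcases hA31 with ⟨h40, h51, h41, h50⟩ | ⟨h41, h50, h40, h51⟩ <;>
      simp [h40, h51, h41, h50, hb] at e1q <;> exact hk e1q
  -- reality of the middle block
  have c2 := hcomm ![0, 0, 1, 0, 0, 0]
  have c3 := hcomm ![0, 0, 0, 1, 0, 0]
  have c22 := congrFun c2 2
  have c23 := congrFun c2 3
  have c32 := congrFun c3 2
  have c33 := congrFun c3 3
  simp only [sigma6, expand, Matrix.cons_val, map_zero, map_one, neg_zero, mul_zero, mul_one,
    zero_add, add_zero, mul_neg] at c22 c23 c32 c33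
  obtain ⟨s, hs⟩ : ∃ s : ℝ, U 2 2 = s := ⟨(U 2 2).re, (conj_eq_iff_re.mp c22.symm).symm⟩
  obtain ⟨ν, hν⟩ : ∃ ν : ℝ, U 3 3 = ν :=
    ⟨(U 3 3).re, (conj_eq_iff_re.mp (neg_injective c33).symm).symm⟩
  have imag {z : ℂ} (h : z = -conj z) : z = I*(z.im : ℝ) := by
    have := congrArg re h
    simp only [neg_re, conj_re] at this
    apply Complex.ext
    · simp; linarith
    · simp
  obtain ⟨τ, hτ⟩ : ∃ τ : ℝ, U 2 3 = I*τ :=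
    ⟨_, imag (by linear_combination -c32)⟩
  obtain ⟨μ, hμ⟩ : ∃ μ : ℝ, U 3 2 = I*μ := ⟨_, imag c23⟩
  rw [hs, hτ, hμ, hν] at e12 e22 e32 e42
  rw [hs, hτ] at hp
  have r1 := sq_eq_sq_of_complex_slopes e12
  have r2 := sq_eq_sq_of_complex_slopes (γ := β) (δ := -α) (by simpa using e22)
  have r3 := sq_eq_sq_of_complex_slopes e32
  have r4 := sq_eq_sq_of_complex_slopes (γ := α) (δ := -β) (by simpa using e42)
  simp only [neg_mul, ← sub_eq_add_neg, sub_neg_eq_add] at r2 r4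
  obtain ⟨hs0, hν0, hμτ⟩ := antidiagonal_of_swap_slopes hne r1 r2 r3 r4
  have hτ0 : τ ≠ 0 := by
    rintro rfl
    simp [hs0] at hp
  rw [hs, hτ, hμ, hν, hs0, hν0]
  rcases hμτ with rfl | rfl
  · refine ⟨I*τ, by simp [hτ0], by simp, Or.inl ⟨by simp, rfl, ?_, by simp⟩⟩
    push_cast; ring
  · refine ⟨-(I*τ), by simp [hτ0], by simp, Or.inr ⟨by simp, by ring, ?_, by simp⟩⟩
    push_cast; ring
end

section
/- Let 0 < α < β be real numbers, and identify each A ∈ GL(2,ℂ) with the map it induces on the complex projective line (so A sends the projective point [x:y] to the projective class of A·(x,y)). Suppose A maps the two-point set {[1:iα], [1:−iα]} onto {[1:iβ], [1:−iβ]} and maps {[1:iβ], [1:−iβ]} onto {[1:iα], [1:−iα]}. Then A is a nonzero scalar multiple of the matrix [[0,1],[αβ,0]] or of the matrix [[0,−1],[αβ,0]]. In particular, of the four conceivable ways such an A could permute these four projective points, only two can actually occur. -/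
open Complex

/-- Two nonzero vectors of `ℂ²` determine the same point of the projective line `ℂP¹`
iff one is a nonzero scalar multiple of the other. -/
def projEq (x y : Fin 2 → ℂ) : Prop := ∃ s : ℂ, s ≠ 0 ∧ x = s • y

/-- If `A` sends `[1:p]` to `[1:q]`, the entries of `A` satisfy the corresponding linear relation. -/
lemma linear_relation_of_projEq_mulVec {A : Matrix (Fin 2) (Fin 2) ℂ} {p q : ℂ}
    (h : projEq (A.mulVec ![1, p]) ![1, q]) :
    A 1 0 + A 1 1 * p = q * (A 0 0 + A 0 1 * p) := by
  obtain ⟨s, -, h⟩ := h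
  have h0 := congrFun h 0
  have h1 := congrFun h 1
  simp [Matrix.mulVec, dotProduct, Fin.sum_univ_two] at h0 h1
  rw [h0, h1, mul_comm]

/-- An invertible `A` mapping `{[1:p],[1:-p]}` into `{[1:q],[1:-q]}` has one of two shapes,
according to which of the two points is the image of `[1:p]`. -/
lemma entries_of_maps_pair {A : Matrix (Fin 2) (Fin 2) ℂ} (hA : A.det ≠ 0) {p q : ℂ} (hp : p ≠ 0)
    (h : ∀ u : Fin 2 → ℂ, (u = ![1, p] ∨ u = ![1, -p]) →
      (projEq (A.mulVec u) ![1, q] ∨ projEq (A.mulVec u) ![1, -q])) :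
    (A 1 0 = p * q * A 0 1 ∧ p * A 1 1 = q * A 0 0) ∨
      (A 1 0 = -(p * q * A 0 1) ∧ p * A 1 1 = -(q * A 0 0)) := by
  rw [Matrix.det_fin_two] at hA
  have not_same (r : ℂ) (h₁ : A 1 0 + A 1 1 * p = r * (A 0 0 + A 0 1 * p))
      (h₂ : A 1 0 + A 1 1 * -p = r * (A 0 0 + A 0 1 * -p)) : False := by
    have hc : A 1 0 = r * A 0 0 := by linear_combination (h₁ + h₂) / 2
    have hd : A 1 1 = r * A 0 1 :=
      mul_left_cancel₀ hp (by linear_combination (h₁ - h₂) / 2)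
    exact hA (by rw [hc, hd]; ring)
  rcases h _ (Or.inl rfl) with h₁ | h₁ <;> rcases h _ (Or.inr rfl) with h₂ | h₂ <;>
    replace h₁ := linear_relation_of_projEq_mulVec h₁ <;>
    replace h₂ := linear_relation_of_projEq_mulVec h₂
  · exact (not_same _ h₁ h₂).elim
  · exact Or.inl ⟨by linear_combination (h₁ + h₂) / 2, by linear_combination (h₁ - h₂) / 2⟩
  · exact Or.inr ⟨by linear_combination (h₁ + h₂) / 2, by linear_combination (h₁ - h₂) / 2⟩
  · exact (not_same _ h₁ h₂).elim

/-- Let `0 < α < β` and `A ∈ GL(2,ℂ)`, inducing a map of `ℂP¹` sending `[x:y]` to the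
class of `A·(x,y)`. If `A` maps the two-point set `{[1:iα],[1:−iα]}` onto
`{[1:iβ],[1:−iβ]}` and maps `{[1:iβ],[1:−iβ]}` onto `{[1:iα],[1:−iα]}`, then `A` is a
nonzero scalar multiple of `[[0,1],[αβ,0]]` or of `[[0,−1],[αβ,0]]`. -/
theorem stmt_16 (α β : ℝ) (hα : 0 < α) (hαβ : α < β)
    (A : Matrix (Fin 2) (Fin 2) ℂ) (hA : IsUnit A.det)
    (hab : ∀ u : Fin 2 → ℂ, (u = ![1, I*(α : ℂ)] ∨ u = ![1, -(I*(α : ℂ))]) →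
      (projEq (A.mulVec u) ![1, I*(β : ℂ)] ∨ projEq (A.mulVec u) ![1, -(I*(β : ℂ))]))
    (hab' : ∀ v : Fin 2 → ℂ, (v = ![1, I*(β : ℂ)] ∨ v = ![1, -(I*(β : ℂ))]) →
      ∃ u : Fin 2 → ℂ, (u = ![1, I*(α : ℂ)] ∨ u = ![1, -(I*(α : ℂ))]) ∧
        projEq (A.mulVec u) v)
    (hba : ∀ u : Fin 2 → ℂ, (u = ![1, I*(β : ℂ)] ∨ u = ![1, -(I*(β : ℂ))]) →
      (projEq (A.mulVec u) ![1, I*(α : ℂ)] ∨ projEq (A.mulVec u) ![1, -(I*(α : ℂ))]))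
    (hba' : ∀ v : Fin 2 → ℂ, (v = ![1, I*(α : ℂ)] ∨ v = ![1, -(I*(α : ℂ))]) →
      ∃ u : Fin 2 → ℂ, (u = ![1, I*(β : ℂ)] ∨ u = ![1, -(I*(β : ℂ))]) ∧
        projEq (A.mulVec u) v) :
    ∃ s : ℂ, s ≠ 0 ∧
      (A = s • !![0, 1; ((α : ℂ)*(β : ℂ)), 0] ∨
       A = s • !![0, -1; ((α : ℂ)*(β : ℂ)), 0]) := by
  have hβ : 0 < β := hα.trans hαβ
  have hαC : (α : ℂ) ≠ 0 := by exact_mod_cast hα.ne'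
  have hβC : (β : ℂ) ≠ 0 := by exact_mod_cast hβ.ne'
  have hsub : (β : ℂ) ^ 2 - (α : ℂ) ^ 2 ≠ 0 := by
    have : β ^ 2 - α ^ 2 ≠ 0 := by nlinarith
    exact_mod_cast this
  have hadd : (β : ℂ) ^ 2 + (α : ℂ) ^ 2 ≠ 0 := by
    have : β ^ 2 + α ^ 2 ≠ 0 := by positivity
    exact_mod_cast this
  have hdet : A.det ≠ 0 := hA.ne_zero
  have h₁ := entries_of_maps_pair hdet (mul_ne_zero I_ne_zero hαC) hab
  have h₂ := entries_of_maps_pair hdet (mul_ne_zero I_ne_zero hβC) hba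
  have ha : A 0 0 = 0 := by
    rcases h₁ with ⟨-, h₁⟩ | ⟨-, h₁⟩ <;> rcases h₂ with ⟨-, h₂⟩ | ⟨-, h₂⟩
    · refine (mul_eq_zero.1 (?_ : ((β : ℂ) ^ 2 - (α : ℂ) ^ 2) * A 0 0 = 0)).resolve_left hsub
      exact mul_left_cancel₀ I_ne_zero (by linear_combination α * h₂ - β * h₁)
    · refine (mul_eq_zero.1 (?_ : ((β : ℂ) ^ 2 + (α : ℂ) ^ 2) * A 0 0 = 0)).resolve_left hadd
      exact mul_left_cancel₀ I_ne_zero (by linear_combination α * h₂ - β * h₁)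
    · refine (mul_eq_zero.1 (?_ : ((β : ℂ) ^ 2 + (α : ℂ) ^ 2) * A 0 0 = 0)).resolve_left hadd
      exact mul_left_cancel₀ I_ne_zero (by linear_combination β * h₁ - α * h₂)
    · refine (mul_eq_zero.1 (?_ : ((β : ℂ) ^ 2 - (α : ℂ) ^ 2) * A 0 0 = 0)).resolve_left hsub
      exact mul_left_cancel₀ I_ne_zero (by linear_combination β * h₁ - α * h₂)
  have hd : A 1 1 = 0 := by
    rcases h₁ with ⟨-, h⟩ | ⟨-, h⟩ <;> simpa [ha, hαC] using h
  have hb : A 0 1 ≠ 0 := by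
    intro hb
    exact hdet (by rw [Matrix.det_fin_two, ha, hb]; ring)
  rcases h₁ with ⟨hc, -⟩ | ⟨hc, -⟩
  · refine ⟨-A 0 1, neg_ne_zero.2 hb, Or.inr ?_⟩
    ext i j
    fin_cases i <;> fin_cases j <;> simp [ha, hd]
    linear_combination hc + α * β * A 0 1 * I_sq
  · refine ⟨A 0 1, hb, Or.inl ?_⟩
    ext i j
    fin_cases i <;> fin_cases j <;> simp [ha, hd]
    linear_combination hc - α * β * A 0 1 * I_sq
end

section
/- Fix λ ∈ ℝ with 3/2 < λ < 2 and set α = √(4 − 2λ), β = √(2λ − 2). Let Λ : ℂ⁶ → ℂ⁶ be the linear map Λ(w₀,w₁,z₂,z₃,w₄,w₅) = (β·w₄, −β·w₅, −i·z₃, i·αβ·z₂, α·w₀, −α·w₁). Then: (i) Λ∘Λ = αβ·id, so Λ induces an involution of projective space; (ii) Λ∘σ = σ∘Λ, where σ is the real structure; (iii) Λ maps D₁' onto D₃', D₃' onto D₁', D̄₂' onto D̄₄', and D̄₄' onto D̄₂'. -/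
open Complex ComplexConjugate

/-- The linear map `Λ(w₀,w₁,z₂,z₃,w₄,w₅) = (βw₄, −βw₅, −iz₃, iαβz₂, αw₀, −αw₁)`. -/
noncomputable def LamMap (α β : ℝ) (v : Fin 6 → ℂ) : Fin 6 → ℂ :=
  ![(β : ℂ)*v 4, -(β : ℂ)*v 5, -I*v 3, I*(α : ℂ)*(β : ℂ)*v 2, (α : ℂ)*v 0, -(α : ℂ)*v 1]

/-- The cone over the torus-invariant degree-one divisor `D₁'`. -/
def D1' (lam α : ℝ) : Set (Fin 6 → ℂ) :=
  {v | (α : ℂ)*v 2 - I*v 3 = 0 ∧ v 4 = 0 ∧ v 0*v 1 + (2*(lam : ℂ) - 3)*(v 2)^2 = 0}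

/-- The cone over the torus-invariant degree-one divisor `D̄₂'`. -/
def D2bar' (lam α : ℝ) : Set (Fin 6 → ℂ) :=
  {v | (α : ℂ)*v 2 + I*v 3 = 0 ∧ v 5 = 0 ∧ v 0*v 1 + (2*(lam : ℂ) - 3)*(v 2)^2 = 0}

/-- The cone over the torus-invariant degree-one divisor `D₃'`. -/
def D3' (lam β : ℝ) : Set (Fin 6 → ℂ) :=
  {v | (β : ℂ)*v 2 - I*v 3 = 0 ∧ v 0 = 0 ∧ (3 - 2*(lam : ℂ))*(v 2)^2 + v 4*v 5 = 0}

/-- The cone over the torus-invariant degree-one divisor `D̄₄'`. -/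
def D4bar' (lam β : ℝ) : Set (Fin 6 → ℂ) :=
  {v | (β : ℂ)*v 2 + I*v 3 = 0 ∧ v 1 = 0 ∧ (3 - 2*(lam : ℂ))*(v 2)^2 + v 4*v 5 = 0}

theorem LamMap_LamMap (α β : ℝ) (v : Fin 6 → ℂ) :
    LamMap α β (LamMap α β v) = ((α : ℂ) * (β : ℂ)) • v := by
  funext i
  fin_cases i <;> simp [LamMap] <;> grind [I_mul_I]

theorem LamMap_smul (α β : ℝ) (c : ℂ) (v : Fin 6 → ℂ) :
    LamMap α β (c • v) = c • LamMap α β v := by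
  funext i
  fin_cases i <;> simp [LamMap] <;> ring

theorem LamMap_sigma6 (α β : ℝ) (v : Fin 6 → ℂ) :
    LamMap α β (sigma6 v) = sigma6 (LamMap α β v) := by
  funext i
  fin_cases i <;> simp [LamMap, sigma6]

theorem smul_mem_D1' {lam α : ℝ} (c : ℂ) {v : Fin 6 → ℂ} (hv : v ∈ D1' lam α) :
    c • v ∈ D1' lam α := by
  obtain ⟨h, h', h''⟩ := hv
  refine ⟨?_, ?_, ?_⟩ <;> simp only [Pi.smul_apply, smul_eq_mul]
  · linear_combination c * h
  · linear_combination c * h'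
  · linear_combination c ^ 2 * h''

theorem smul_mem_D2bar' {lam α : ℝ} (c : ℂ) {v : Fin 6 → ℂ} (hv : v ∈ D2bar' lam α) :
    c • v ∈ D2bar' lam α := by
  obtain ⟨h, h', h''⟩ := hv
  refine ⟨?_, ?_, ?_⟩ <;> simp only [Pi.smul_apply, smul_eq_mul]
  · linear_combination c * h
  · linear_combination c * h'
  · linear_combination c ^ 2 * h''

theorem smul_mem_D3' {lam β : ℝ} (c : ℂ) {v : Fin 6 → ℂ} (hv : v ∈ D3' lam β) :
    c • v ∈ D3' lam β := by
  obtain ⟨h, h', h''⟩ := hv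
  refine ⟨?_, ?_, ?_⟩ <;> simp only [Pi.smul_apply, smul_eq_mul]
  · linear_combination c * h
  · linear_combination c * h'
  · linear_combination c ^ 2 * h''

theorem smul_mem_D4bar' {lam β : ℝ} (c : ℂ) {v : Fin 6 → ℂ} (hv : v ∈ D4bar' lam β) :
    c • v ∈ D4bar' lam β := by
  obtain ⟨h, h', h''⟩ := hv
  refine ⟨?_, ?_, ?_⟩ <;> simp only [Pi.smul_apply, smul_eq_mul]
  · linear_combination c * h
  · linear_combination c * h'
  · linear_combination c ^ 2 * h''

theorem mapsTo_LamMap_D1' (lam α β : ℝ) :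
    Set.MapsTo (LamMap α β) (D1' lam α) (D3' lam β) := by
  rintro v ⟨h, h', h''⟩
  refine ⟨?_, ?_, ?_⟩ <;> simp [LamMap] <;> grind [I_mul_I]

theorem mapsTo_LamMap_D3' (lam α β : ℝ) :
    Set.MapsTo (LamMap α β) (D3' lam β) (D1' lam α) := by
  rintro v ⟨h, h', h''⟩
  refine ⟨?_, ?_, ?_⟩ <;> simp [LamMap] <;> grind [I_mul_I]

theorem mapsTo_LamMap_D2bar' (lam α β : ℝ) :
    Set.MapsTo (LamMap α β) (D2bar' lam α) (D4bar' lam β) := by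
  rintro v ⟨h, h', h''⟩
  refine ⟨?_, ?_, ?_⟩ <;> simp [LamMap] <;> grind [I_mul_I]

theorem mapsTo_LamMap_D4bar' (lam α β : ℝ) :
    Set.MapsTo (LamMap α β) (D4bar' lam β) (D2bar' lam α) := by
  rintro v ⟨h, h', h''⟩
  refine ⟨?_, ?_, ?_⟩ <;> simp [LamMap] <;> grind [I_mul_I]

/-- If `Λ` exchanges `A` and `B`, and `A` is a cone, then `Λ` maps `A` onto `B`. -/
theorem LamMap_image_eq {α β : ℝ} (hα : α ≠ 0) (hβ : β ≠ 0) {A B : Set (Fin 6 → ℂ)}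
    (hAB : Set.MapsTo (LamMap α β) A B) (hBA : Set.MapsTo (LamMap α β) B A)
    (hA : ∀ (c : ℂ) {v : Fin 6 → ℂ}, v ∈ A → c • v ∈ A) : LamMap α β '' A = B := by
  have hc : (α : ℂ) * (β : ℂ) ≠ 0 := by simp [hα, hβ]
  refine hAB.image_subset.antisymm fun u hu => ⟨_, hA ((α : ℂ) * (β : ℂ))⁻¹ (hBA hu), ?_⟩
  rw [LamMap_smul, LamMap_LamMap, inv_smul_smul₀ hc]

/-- For `3/2 < λ < 2`, `α = √(4−2λ)`, `β = √(2λ−2)`, the linear map `Λ` satisfies: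
(i) `Λ∘Λ = αβ·id`, so it induces an involution of projective space;
(ii) `Λ` commutes with the real structure `σ`;
(iii) `Λ` maps `D₁'` onto `D₃'`, `D₃'` onto `D₁'`, `D̄₂'` onto `D̄₄'`, `D̄₄'` onto `D̄₂'`. -/
theorem stmt_17 (lam α β : ℝ) (h₁ : 3/2 < lam) (h₂ : lam < 2)
    (hα : α = Real.sqrt (4 - 2*lam)) (hβ : β = Real.sqrt (2*lam - 2)) :
    (∀ v : Fin 6 → ℂ, LamMap α β (LamMap α β v) = ((α : ℂ)*(β : ℂ)) • v) ∧
    (∀ v : Fin 6 → ℂ, LamMap α β (sigma6 v) = sigma6 (LamMap α β v)) ∧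
    (LamMap α β '' D1' lam α = D3' lam β ∧
     LamMap α β '' D3' lam β = D1' lam α ∧
     LamMap α β '' D2bar' lam α = D4bar' lam β ∧
     LamMap α β '' D4bar' lam β = D2bar' lam α) := by
  have hα0 : α ≠ 0 := hα ▸ (Real.sqrt_pos.2 (by linarith)).ne'
  have hβ0 : β ≠ 0 := hβ ▸ (Real.sqrt_pos.2 (by linarith)).ne'
  have h13 := mapsTo_LamMap_D1' lam α β
  have h31 := mapsTo_LamMap_D3' lam α β
  have h24 := mapsTo_LamMap_D2bar' lam α β
  have h42 := mapsTo_LamMap_D4bar' lam α β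
  exact ⟨LamMap_LamMap α β, LamMap_sigma6 α β,
    LamMap_image_eq hα0 hβ0 h13 h31 smul_mem_D1', LamMap_image_eq hα0 hβ0 h31 h13 smul_mem_D3',
    LamMap_image_eq hα0 hβ0 h24 h42 smul_mem_D2bar',
    LamMap_image_eq hα0 hβ0 h42 h24 smul_mem_D4bar'⟩
end
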